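/- Let d ≥ 3 and θ > 0. Let 𝒬 be a family of cubes satisfying (G), and let ω : ℝ^d → ℝ be measurable with 0 < δ ≤ ω(x) ≤ 1 for all x and some δ > 0. Assume there exist C₀ > 0 and λ > 0 such that |ω(x) − ω(y)| ≤ C₀ (|x − y| / d_Q)^λ for every Q ∈ 𝒬 and all x, y ∈ Q**. Then there is a constant C > 0 such that for every f ∈ L¹(ℝ^d): f ∈ H¹_at(𝒜_𝒬) if and only if f ∈ H¹_at(𝒜_{ω,𝒬}), and in that case C^{-1} ‖f‖_{H¹_at(𝒜_𝒬)} ≤ ‖f‖_{H¹_at(𝒜_{ω,𝒬})} ≤ C ‖f‖_{H¹_at(𝒜_𝒬)}. -/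

import Mathlib

open MeasureTheory Filter
open scoped ENNReal

noncomputable section

/-- `ℝ^d` as a Euclidean space. -/
abbrev Rd (d : ℕ) := EuclideanSpace ℝ (Fin d)

/-- A cube in `ℝ^d`, given by its center and (positive) radius. -/
structure Cube (d : ℕ) where
  center : Rd d
  radius : ℝ
  radius_pos : 0 < radius

/-- The underlying open set of a cube: `Q(c,r) = {y : max_i |c_i - y_i| < r}`. -/
def Cube.carrier {d : ℕ} (Q : Cube d) : Set (Rd d) :=
  {y | ∀ i, |Q.center i - y i| < Q.radius}

/-- The diameter `d_Q = 2 √d · r_Q` of a cube. -/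
def Cube.diam {d : ℕ} (Q : Cube d) : ℝ := 2 * Real.sqrt d * Q.radius

/-- The `k`-fold enlargement `Q^{*k} = Q(c_Q, (1+θ)^k r_Q)` of a cube, as a set. -/
def Cube.starSet {d : ℕ} (Q : Cube d) (θ : ℝ) (k : ℕ) : Set (Rd d) :=
  {y | ∀ i, |Q.center i - y i| < (1 + θ) ^ k * Q.radius}

/-- The condition (G) on a family of cubes: it is countable, the closures cover `ℝ^d`,
distinct cubes overlap in measure zero, and cubes whose fourfold enlargements meet have
comparable diameters (with constant `CG`). -/
def SatG {d : ℕ} (θ CG : ℝ) (𝒬 : Set (Cube d)) : Prop :=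
  𝒬.Countable ∧
  (⋃ Q ∈ 𝒬, closure Q.carrier) = Set.univ ∧
  (∀ Q₁ ∈ 𝒬, ∀ Q₂ ∈ 𝒬, Q₁ ≠ Q₂ → volume (Q₁.carrier ∩ Q₂.carrier) = 0) ∧
  (∀ Q₁ ∈ 𝒬, ∀ Q₂ ∈ 𝒬, (Q₁.starSet θ 4 ∩ Q₂.starSet θ 4).Nonempty →
    CG⁻¹ * Q₁.diam ≤ Q₂.diam ∧ Q₂.diam ≤ CG * Q₁.diam)

/-- An `(ω,𝒬)`-atom: either a function supported in a cube `K ⊆ Q^{**}` (`Q ∈ 𝒬`) with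
`‖a‖_∞ ≤ |K|⁻¹` and `∫_K a ω = 0`, or `a = |Q|⁻¹ χ_Q` for some `Q ∈ 𝒬`.
Taking `ω ≡ 1` gives the notion of a `𝒬`-atom. -/
def IsWAtom {d : ℕ} (θ : ℝ) (𝒬 : Set (Cube d)) (ω : Rd d → ℝ) (a : Rd d → ℝ) : Prop :=
  Integrable a ∧
  ((∃ Q ∈ 𝒬, ∃ K : Cube d, K.carrier ⊆ Q.starSet θ 2 ∧
      Function.support a ⊆ K.carrier ∧
      (∀ᵐ x ∂volume, |a x| ≤ ((volume K.carrier).toReal)⁻¹) ∧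
      ∫ x in K.carrier, a x * ω x = 0) ∨
    (∃ Q ∈ 𝒬, a = (Q.carrier).indicator (fun _ => ((volume Q.carrier).toReal)⁻¹)))

/-- `f = ∑ λ_j a_j` is an atomic decomposition: all `a_j` are atoms (i.e. satisfy `𝒜`),
`∑ |λ_j| < ∞`, and the partial sums converge to `f` in `L¹`. -/
def IsDecomp {d : ℕ} (𝒜 : (Rd d → ℝ) → Prop) (f : Rd d → ℝ)
    (lam : ℕ → ℝ) (a : ℕ → Rd d → ℝ) : Prop :=
  (∀ j, 𝒜 (a j)) ∧ Summable (fun j => |lam j|) ∧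
  Tendsto (fun N => ∫ x, |f x - ∑ j ∈ Finset.range N, lam j * a j x|) atTop (nhds 0)

/-- Membership in the atomic Hardy space `H¹_at(𝒜)`. -/
def MemH1at {d : ℕ} (𝒜 : (Rd d → ℝ) → Prop) (f : Rd d → ℝ) : Prop :=
  ∃ lam a, IsDecomp 𝒜 f lam a

/-- The atomic norm `‖f‖_{H¹_at(𝒜)} = inf ∑ |λ_j|` over all atomic decompositions. -/
def H1atNorm {d : ℕ} (𝒜 : (Rd d → ℝ) → Prop) (f : Rd d → ℝ) : ℝ :=
  sInf {s | ∃ lam a, IsDecomp 𝒜 f lam a ∧ s = ∑' j, |lam j|}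

/-- `F` is the sum of a series `∑ λ_j b_j` with `b_j ∈ S` and `∑ |λ_j| ≤ C`. -/
def AtomicSum {E : Type*} [NormedAddCommGroup E] [NormedSpace ℝ E] (S : Set E) (F : E) (C : ℝ) :
    Prop :=
  ∃ (lam : ℕ → ℝ) (b : ℕ → E), (∀ j, b j ∈ S) ∧ Summable (fun j => |lam j|) ∧
    HasSum (fun j => lam j • b j) F ∧ ∑' j, |lam j| ≤ C

namespace AtomicSum

variable {E : Type*} [NormedAddCommGroup E] [NormedSpace ℝ E] {S : Set E} {F G : E} {C D : ℝ}

theorem mono (h : AtomicSum S F C) (hCD : C ≤ D) : AtomicSum S F D := by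
  obtain ⟨lam, b, h1, h2, h3, h4⟩ := h
  exact ⟨lam, b, h1, h2, h3, h4.trans hCD⟩

theorem smul (h : AtomicSum S F C) (c : ℝ) : AtomicSum S (c • F) (|c| * C) := by
  obtain ⟨lam, b, h1, h2, h3, h4⟩ := h
  refine ⟨fun j => c * lam j, b, h1, ?_, ?_, ?_⟩
  · simpa only [abs_mul] using h2.mul_left |c|
  · simpa only [mul_smul] using h3.const_smul c
  · simp only [abs_mul, tsum_mul_left]
    gcongr

theorem of_mem (hF : F ∈ S) : AtomicSum S F 1 := by
  refine ⟨fun j => if j = 0 then 1 else 0, fun _ => F, fun _ => hF, ?_, ?_, ?_⟩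
  · exact summable_of_ne_finset_zero (s := {0}) (by intro j hj; simp at hj; simp [hj])
  · simpa using hasSum_single (f := fun j : ℕ => (if j = 0 then (1 : ℝ) else 0) • F) 0
      (by intro j hj; simp [hj])
  · rw [tsum_eq_single 0 (by intro j hj; simp [hj])]
    simp

theorem zero (hS : S.Nonempty) : AtomicSum S 0 0 := by
  obtain ⟨F, hF⟩ := hS
  simpa using (of_mem hF).smul 0

/-- Countable sums of atomic sums are atomic sums. -/
theorem hasSum [CompleteSpace E] (hS : ∀ b ∈ S, ‖b‖ ≤ 1) {f : ℕ → E} {c : ℕ → ℝ}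
    (hf : ∀ j, AtomicSum S (f j) (c j)) (hc : Summable c) (hF : HasSum f F) :
    AtomicSum S F (∑' j, c j) := by
  choose lam b hb hlam hsum hle using hf
  let e : ℕ ≃ ℕ × ℕ := (Nat.pairEquiv).symm
  have hnn : ∀ j, 0 ≤ ∑' k, |lam j k| := fun j => tsum_nonneg fun k => abs_nonneg _
  have hs1 : Summable fun j => ∑' k, |lam j k| := Summable.of_nonneg_of_le hnn hle hc
  have hs2 : Summable fun p : ℕ × ℕ => |lam p.1 p.2| :=
    (summable_prod_of_nonneg fun p => abs_nonneg _).2 ⟨hlam, hs1⟩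
  have hs3 : Summable fun p : ℕ × ℕ => lam p.1 p.2 • b p.1 p.2 := by
    refine Summable.of_norm_bounded hs2 fun p => ?_
    rw [norm_smul, Real.norm_eq_abs]
    exact mul_le_of_le_one_right (abs_nonneg _) (hS _ (hb _ _))
  have hs4 : HasSum (fun p : ℕ × ℕ => lam p.1 p.2 • b p.1 p.2) F := by
    have h := hs3.hasSum
    have h' := h.prod_fiberwise hsum
    rwa [h'.unique hF] at h
  refine ⟨fun n => lam (e n).1 (e n).2, fun n => b (e n).1 (e n).2, fun n => hb _ _,
    (e.summable_iff (f := fun p : ℕ × ℕ => |lam p.1 p.2|)).2 hs2,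
    (e.hasSum_iff (f := fun p : ℕ × ℕ => lam p.1 p.2 • b p.1 p.2)).2 hs4, ?_⟩
  rw [e.tsum_eq (fun p : ℕ × ℕ => |lam p.1 p.2|), hs2.tsum_prod]
  exact hs1.tsum_le_tsum hle hc

theorem add [CompleteSpace E] (hS : ∀ b ∈ S, ‖b‖ ≤ 1) (hF : AtomicSum S F C)
    (hG : AtomicSum S G D) : AtomicSum S (F + G) (C + D) := by
  have hne : S.Nonempty := by
    obtain ⟨lam, b, hb, h⟩ := hF
    exact ⟨b 0, hb 0⟩
  let f : ℕ → E := fun j => if j = 0 then F else if j = 1 then G else 0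
  let c : ℕ → ℝ := fun j => if j = 0 then C else if j = 1 then D else 0
  have h0 : ∀ j ∉ Finset.range 2, f j = 0 := by
    intro j hj
    simp only [Finset.mem_range, not_lt] at hj
    simp only [f]
    rw [if_neg (by omega), if_neg (by omega)]
  have h0' : ∀ j ∉ Finset.range 2, c j = 0 := by
    intro j hj
    simp only [Finset.mem_range, not_lt] at hj
    simp only [c]
    rw [if_neg (by omega), if_neg (by omega)]
  have h1 : HasSum f (F + G) := by
    simpa [f, Finset.sum_range_succ] using hasSum_sum_of_ne_finset_zero h0
  have h2 : HasSum c (C + D) := by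
    simpa [c, Finset.sum_range_succ] using hasSum_sum_of_ne_finset_zero h0'
  rw [← h2.tsum_eq]
  refine hasSum hS (fun j => ?_) h2.summable h1
  simp only [f, c]
  split_ifs
  · exact hF
  · exact hG
  · exact zero hne

end AtomicSum

/-- The classes in `L¹` of the integrable functions satisfying `𝒜`. -/
def atomClasses {d : ℕ} (𝒜 : (Rd d → ℝ) → Prop) : Set (Rd d →₁[volume] ℝ) :=
  {b | ∃ (a : Rd d → ℝ) (ha : Integrable a), 𝒜 a ∧ ha.toL1 a = b}

theorem norm_toL1_eq_integral_abs {d : ℕ} {f : Rd d → ℝ} (hf : Integrable f) :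
    ‖hf.toL1 f‖ = ∫ x, |f x| := by
  exact L1.norm_of_fun_eq_integral_norm hf

theorem tendsto_integral_abs_sub_iff_hasSum {d : ℕ} {𝒜 : (Rd d → ℝ) → Prop}
    (h𝒜 : ∀ a, 𝒜 a → Integrable a) (hle : ∀ b ∈ atomClasses 𝒜, ‖b‖ ≤ 1)
    {f : Rd d → ℝ} (hf : Integrable f) {lam : ℕ → ℝ} {a : ℕ → Rd d → ℝ}
    (h : ∀ j, 𝒜 (a j)) (hlam : Summable fun j => |lam j|) :
    Tendsto (fun N => ∫ x, |f x - ∑ j ∈ Finset.range N, lam j * a j x|) atTop (nhds 0) ↔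
      HasSum (fun j => lam j • (h𝒜 _ (h j)).toL1 (a j)) (hf.toL1 f) := by
  have hsumm : Summable (fun j => lam j • (h𝒜 _ (h j)).toL1 (a j)) := by
    refine Summable.of_norm_bounded hlam fun j => ?_
    rw [norm_smul, Real.norm_eq_abs]
    exact mul_le_of_le_one_right (abs_nonneg _) (hle _ ⟨_, _, h j, rfl⟩)
  have key : ∀ N, ∫ x, |f x - ∑ j ∈ Finset.range N, lam j * a j x| =
      ‖∑ j ∈ Finset.range N, lam j • (h𝒜 _ (h j)).toL1 (a j) - hf.toL1 f‖ := by
    intro N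
    have hint : Integrable (fun x => ∑ j ∈ Finset.range N, lam j * a j x) :=
      integrable_finsetSum _ fun j _ => (h𝒜 _ (h j)).const_mul _
    have h1 : hint.toL1 _ = ∑ j ∈ Finset.range N, lam j • (h𝒜 _ (h j)).toL1 (a j) := by
      clear hsumm
      induction N with
      | zero => simp; rfl
      | succ N ih =>
        have hint' : Integrable (fun x => ∑ j ∈ Finset.range N, lam j * a j x) :=
          integrable_finsetSum _ fun j _ => (h𝒜 _ (h j)).const_mul _
        rw [Finset.sum_range_succ, ← ih hint', ← Integrable.toL1_smul, ← Integrable.toL1_add]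
        simp only [Integrable.toL1_eq_toL1_iff]
        refine Eventually.of_forall fun x => ?_
        simp [Finset.sum_range_succ]
    rw [← h1, norm_sub_rev, ← Integrable.toL1_sub, norm_toL1_eq_integral_abs]
    rfl
  simp_rw [key, ← tendsto_iff_norm_sub_tendsto_zero]
  refine ⟨fun ht => ?_, fun ht => ht.tendsto_sum_nat⟩
  have := hsumm.hasSum
  rwa [tendsto_nhds_unique this.tendsto_sum_nat ht] at this

theorem atomicSum_toL1_iff {d : ℕ} {𝒜 : (Rd d → ℝ) → Prop} (h𝒜 : ∀ a, 𝒜 a → Integrable a)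
    (hle : ∀ b ∈ atomClasses 𝒜, ‖b‖ ≤ 1) {f : Rd d → ℝ} (hf : Integrable f) {C : ℝ} :
    AtomicSum (atomClasses 𝒜) (hf.toL1 f) C ↔
      ∃ lam a, IsDecomp 𝒜 f lam a ∧ ∑' j, |lam j| ≤ C := by
  constructor
  · rintro ⟨lam, b, hb, hlam, hsum, hC⟩
    choose a ha hA hab using hb
    refine ⟨lam, a, ⟨hA, hlam, ?_⟩, hC⟩
    rw [tendsto_integral_abs_sub_iff_hasSum h𝒜 hle hf hA hlam]
    simpa only [hab] using hsum
  · rintro ⟨lam, a, ⟨hA, hlam, ht⟩, hC⟩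
    exact ⟨lam, _, fun j => ⟨a j, h𝒜 _ (hA j), hA j, rfl⟩, hlam,
      (tendsto_integral_abs_sub_iff_hasSum h𝒜 hle hf hA hlam).1 ht, hC⟩

/-- If every `𝒜`-atom is a sum of `ℬ`-atoms with coefficients summing to at most `K`, then
`H¹_at(𝒜)` embeds into `H¹_at(ℬ)` with norm at most `K`. -/
theorem H1atNorm_le_of_atomicSum {d : ℕ} {𝒜 ℬ : (Rd d → ℝ) → Prop}
    (h𝒜 : ∀ a, 𝒜 a → Integrable a) (h𝒜le : ∀ b ∈ atomClasses 𝒜, ‖b‖ ≤ 1)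
    (hℬ : ∀ a, ℬ a → Integrable a) (hℬle : ∀ b ∈ atomClasses ℬ, ‖b‖ ≤ 1)
    {K : ℝ} (hK : 0 < K) (h : ∀ F ∈ atomClasses 𝒜, AtomicSum (atomClasses ℬ) F K)
    {f : Rd d → ℝ} (hf : Integrable f) (hmem : MemH1at 𝒜 f) :
    MemH1at ℬ f ∧ H1atNorm ℬ f ≤ K * H1atNorm 𝒜 f := by
  have key : ∀ lam a, IsDecomp 𝒜 f lam a →
      ∃ lam' a', IsDecomp ℬ f lam' a' ∧ ∑' j, |lam' j| ≤ K * ∑' j, |lam j| := by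
    rintro lam a ⟨hA, hlam, ht⟩
    rw [← atomicSum_toL1_iff hℬ hℬle hf, mul_comm, ← tsum_mul_right]
    refine AtomicSum.hasSum hℬle (fun j => ?_) (hlam.mul_right K)
      ((tendsto_integral_abs_sub_iff_hasSum h𝒜 h𝒜le hf hA hlam).1 ht)
    exact (h _ ⟨a j, h𝒜 _ (hA j), hA j, rfl⟩).smul (lam j)
  obtain ⟨lam, a, hdec⟩ := hmem
  obtain ⟨lam', a', hdec', -⟩ := key lam a hdec
  refine ⟨⟨lam', a', hdec'⟩, ?_⟩
  rw [← div_le_iff₀' hK]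
  refine le_csInf ⟨_, lam, a, hdec, rfl⟩ ?_
  rintro _ ⟨lam, a, hdec, rfl⟩
  obtain ⟨lam', a', hdec', hle⟩ := key lam a hdec
  rw [div_le_iff₀' hK]
  refine le_trans (csInf_le ⟨0, ?_⟩ ⟨lam', a', hdec', rfl⟩) hle
  rintro _ ⟨_, _, _, rfl⟩
  exact tsum_nonneg fun _ => abs_nonneg _

namespace Cube

variable {d : ℕ}

theorem carrier_eq_preimage (Q : Cube d) :
    Q.carrier = WithLp.ofLp ⁻¹' Set.univ.pi
      (fun i => Set.Ioo (Q.center i - Q.radius) (Q.center i + Q.radius)) := by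
  ext y
  simp only [carrier, Set.mem_ofPred_eq, Set.mem_preimage, Set.mem_pi, Set.mem_univ, true_imp_iff,
    Set.mem_Ioo, abs_sub_lt_iff]
  refine forall_congr' fun i => ?_
  constructor <;> rintro ⟨h1, h2⟩ <;> constructor <;> linarith

theorem measurableSet_carrier (Q : Cube d) : MeasurableSet Q.carrier := by
  rw [carrier_eq_preimage]
  exact (PiLp.volume_preserving_ofLp (Fin d)).measurable
    (MeasurableSet.univ_pi fun _ => measurableSet_Ioo)

theorem volume_carrier (Q : Cube d) : volume Q.carrier = ENNReal.ofReal ((2 * Q.radius) ^ d) := by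
  rw [carrier_eq_preimage, (PiLp.volume_preserving_ofLp (Fin d)).measure_preimage
    (MeasurableSet.univ_pi fun _ => measurableSet_Ioo).nullMeasurableSet, Real.volume_pi_Ioo,
    ENNReal.ofReal_pow (by linarith [Q.radius_pos])]
  simp [two_mul]

theorem volume_carrier_ne_top (Q : Cube d) : volume Q.carrier ≠ ∞ := by
  simp [volume_carrier]

theorem toReal_volume_carrier (Q : Cube d) :
    (volume Q.carrier).toReal = (2 * Q.radius) ^ d := by
  have := Q.radius_pos
  rw [volume_carrier, ENNReal.toReal_ofReal (by positivity)]

theorem toReal_volume_carrier_pos (Q : Cube d) : 0 < (volume Q.carrier).toReal := by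
  have := Q.radius_pos
  rw [toReal_volume_carrier]
  positivity

theorem carrier_subset_iff {K B : Cube d} :
    K.carrier ⊆ B.carrier ↔ ∀ i, |B.center i - K.center i| + K.radius ≤ B.radius := by
  constructor
  · intro h i
    by_contra! hi
    have hK := K.radius_pos
    set t := B.center i - K.center i with ht
    -- a point of `K` whose `i`-th coordinate is too far from the center of `B`
    obtain ⟨s, hs0, hsK, hs⟩ : ∃ s, 0 ≤ s ∧ s < K.radius ∧ B.radius ≤ |t| + s :=
      ⟨max 0 (B.radius - |t|), le_max_left _ _, max_lt hK (by linarith),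
        by linarith [le_max_right 0 (B.radius - |t|)]⟩
    obtain ⟨u, hu, hu'⟩ : ∃ u, |u| < K.radius ∧ B.radius ≤ |t + u| := by
      rcases le_total 0 t with h0 | h0
      · exact ⟨s, by rwa [abs_of_nonneg hs0], by
          rw [abs_of_nonneg h0] at hs
          exact hs.trans (le_abs_self _)⟩
      · exact ⟨-s, by rwa [abs_neg, abs_of_nonneg hs0], by
          rw [abs_of_nonpos h0] at hs
          exact le_trans (by linarith) (neg_le_abs (t + -s))⟩
    have hy : WithLp.toLp 2 (Function.update (fun j => K.center j) i (K.center i - u)) ∈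
        K.carrier := by
      intro j
      by_cases hj : j = i
      · subst hj; simpa using hu
      · simpa [hj] using hK
    have := h hy i
    simp only [Function.update_self] at this
    rw [show B.center i - (K.center i - u) = t + u by rw [ht]; ring] at this
    linarith
  · intro h y hy i
    have h1 := abs_add_le (B.center i - K.center i) (K.center i - y i)
    rw [sub_add_sub_cancel] at h1
    linarith [h i, hy i]

theorem radius_le_of_subset (hd : 0 < d) {K B : Cube d} (h : K.carrier ⊆ B.carrier) :
    K.radius ≤ B.radius := by
  have := carrier_subset_iff.1 h ⟨0, hd⟩
  linarith [abs_nonneg (B.center ⟨0, hd⟩ - K.center ⟨0, hd⟩)]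

/-- Between two nested cubes there is a cube of every intermediate radius. -/
theorem exists_between {K B : Cube d} (h : K.carrier ⊆ B.carrier) {r : ℝ} (hK : K.radius < r)
    (hB : r ≤ B.radius) :
    ∃ K' : Cube d, K'.radius = r ∧ K.carrier ⊆ K'.carrier ∧ K'.carrier ⊆ B.carrier := by
  have hpos : 0 < B.radius - K.radius := by linarith
  set t := (r - K.radius) / (B.radius - K.radius) with ht
  have htr : t * (B.radius - K.radius) = r - K.radius := div_mul_cancel₀ _ hpos.ne'
  have ht0 : 0 ≤ t := div_nonneg (by linarith) hpos.le
  have ht1 : t ≤ 1 := (div_le_one hpos).2 (by linarith)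
  refine ⟨⟨K.center + t • (B.center - K.center), r, K.radius_pos.trans hK⟩, rfl, ?_, ?_⟩
  · refine carrier_subset_iff.2 fun i => ?_
    have := carrier_subset_iff.1 h i
    simp only [PiLp.add_apply, PiLp.smul_apply, PiLp.sub_apply, smul_eq_mul, add_sub_cancel_left,
      abs_mul, abs_of_nonneg ht0]
    nlinarith
  · refine carrier_subset_iff.2 fun i => ?_
    have := carrier_subset_iff.1 h i
    simp only [PiLp.add_apply, PiLp.smul_apply, PiLp.sub_apply, smul_eq_mul]
    rw [show B.center i - (K.center i + t * (B.center i - K.center i)) =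
      (1 - t) * (B.center i - K.center i) by ring, abs_mul, abs_of_nonneg (by linarith)]
    nlinarith

theorem norm_sub_le_diam (K : Cube d) {x y : Rd d} (hx : x ∈ K.carrier) (hy : y ∈ K.carrier) :
    ‖x - y‖ ≤ K.diam := by
  have hr := K.radius_pos
  rw [EuclideanSpace.norm_eq]
  refine Real.sqrt_le_iff.2 ⟨by unfold diam; positivity, ?_⟩
  have h : ∀ i, ‖(x - y) i‖ ^ 2 ≤ (2 * K.radius) ^ 2 := by
    intro i
    have h1 := abs_sub_lt_iff.1 (hx i)
    have h2 := abs_sub_lt_iff.1 (hy i)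
    rw [PiLp.sub_apply, Real.norm_eq_abs, sq_le_sq, abs_abs,
      abs_of_pos (by linarith : 0 < 2 * K.radius)]
    exact abs_le.2 ⟨by linarith, by linarith⟩
  calc _ ≤ ∑ _i : Fin d, (2 * K.radius) ^ 2 := Finset.sum_le_sum fun i _ => h i
    _ = K.diam ^ 2 := by
      rw [diam, mul_right_comm, mul_pow _ (Real.sqrt d), Real.sq_sqrt (by positivity)]
      simp [mul_comm]

theorem center_mem (K : Cube d) : K.center ∈ K.carrier := fun i => by simpa using K.radius_pos

/-- The enlargement `Q^{*k}` as a cube. -/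
def star (Q : Cube d) {θ : ℝ} (hθ : 0 < θ) (k : ℕ) : Cube d :=
  ⟨Q.center, (1 + θ) ^ k * Q.radius, mul_pos (by positivity) Q.radius_pos⟩

theorem carrier_star (Q : Cube d) {θ : ℝ} (hθ : 0 < θ) (k : ℕ) :
    (Q.star hθ k).carrier = Q.starSet θ k := rfl

theorem carrier_subset_star (Q : Cube d) {θ : ℝ} (hθ : 0 < θ) (k : ℕ) :
    Q.carrier ⊆ (Q.star hθ k).carrier := by
  refine carrier_subset_iff.2 fun i => ?_
  simp only [star, sub_self, abs_zero, zero_add]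
  exact le_mul_of_one_le_left Q.radius_pos.le (one_le_pow₀ (by linarith))

end Cube

section Atoms

variable {d : ℕ} {θ : ℝ} {𝒬 : Set (Cube d)} {w : Rd d → ℝ} {δ : ℝ}

theorem norm_le_one_of_mem_atomClasses :
    ∀ b ∈ atomClasses (IsWAtom θ 𝒬 w), ‖b‖ ≤ 1 := by
  have main : ∀ (K : Cube d) (a : Rd d → ℝ), Function.support a ⊆ K.carrier →
      (∀ᵐ x ∂volume, |a x| ≤ ((volume K.carrier).toReal)⁻¹) → ∫ x, |a x| ≤ 1 := by
    intro K a hsupp hbd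
    have h1 : ∫ x, |a x| = ∫ x in K.carrier, |a x| := by
      rw [setIntegral_eq_integral_of_forall_compl_eq_zero]
      intro x hx
      rw [Function.notMem_support.1 fun h => hx (hsupp h), abs_zero]
    have h2 := norm_setIntegral_le_of_norm_le_const_ae' (f := fun x => |a x|)
      K.volume_carrier_ne_top.lt_top
      (hbd.mono fun x hx _ => by simpa only [Real.norm_eq_abs, abs_abs] using hx)
    rw [h1]
    refine (le_abs_self _).trans (h2.trans ?_)
    rw [measureReal_def, inv_mul_cancel₀ K.toReal_volume_carrier_pos.ne']
  rintro _ ⟨a, ha, ⟨-, ⟨Q, -, K, -, hsupp, hbd, -⟩ | ⟨Q, -, rfl⟩⟩, rfl⟩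
  · rw [norm_toL1_eq_integral_abs]
    exact main K a hsupp hbd
  · rw [norm_toL1_eq_integral_abs]
    refine main Q _ Set.support_indicator_subset (Eventually.of_forall fun x => ?_)
    have := Q.toReal_volume_carrier_pos
    by_cases hx : x ∈ Q.carrier
    · simp [hx]
    · simp [hx]

/-- The function `f` is integrable and a sum of `(w,𝒬)`-atoms with coefficients whose absolute
values sum to at most `C`. -/
def IsAtomicSum (θ : ℝ) (𝒬 : Set (Cube d)) (w f : Rd d → ℝ) (C : ℝ) : Prop :=
  ∃ hf : Integrable f, AtomicSum (atomClasses (IsWAtom θ 𝒬 w)) (hf.toL1 f) C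

namespace IsAtomicSum

variable {f g : Rd d → ℝ} {C D : ℝ}

theorem add (hf : IsAtomicSum θ 𝒬 w f C) (hg : IsAtomicSum θ 𝒬 w g D) :
    IsAtomicSum θ 𝒬 w (f + g) (C + D) := by
  obtain ⟨hf, hF⟩ := hf
  obtain ⟨hg, hG⟩ := hg
  exact ⟨hf.add hg, hF.add norm_le_one_of_mem_atomClasses hG⟩

theorem smul (hf : IsAtomicSum θ 𝒬 w f C) (c : ℝ) : IsAtomicSum θ 𝒬 w (c • f) (|c| * C) := by
  obtain ⟨hf, hF⟩ := hf
  exact ⟨hf.smul c, hF.smul c⟩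

theorem mono (hf : IsAtomicSum θ 𝒬 w f C) (h : C ≤ D) : IsAtomicSum θ 𝒬 w f D := by
  obtain ⟨hf, hF⟩ := hf
  exact ⟨hf, hF.mono h⟩

theorem sub (hf : IsAtomicSum θ 𝒬 w f C) (hg : IsAtomicSum θ 𝒬 w g D) :
    IsAtomicSum θ 𝒬 w (f - g) (C + D) := by
  have := hf.add (hg.smul (-1))
  rwa [neg_one_smul, ← sub_eq_add_neg, abs_neg, abs_one, one_mul] at this

theorem of_isWAtom (hf : IsWAtom θ 𝒬 w f) : IsAtomicSum θ 𝒬 w f 1 :=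
  ⟨hf.1, AtomicSum.of_mem ⟨f, hf.1, hf, rfl⟩⟩

/-- A multiple of an atom with cancellation. -/
theorem of_integral_eq_zero {Q : Cube d} (hQ : Q ∈ 𝒬) {K : Cube d}
    (hK : K.carrier ⊆ Q.starSet θ 2) (hf : Integrable f) (hsupp : Function.support f ⊆ K.carrier)
    {M : ℝ} (hM : 0 < M) (hbd : ∀ᵐ x ∂volume, |f x| ≤ M * ((volume K.carrier).toReal)⁻¹)
    (h0 : ∫ x in K.carrier, f x * w x = 0) : IsAtomicSum θ 𝒬 w f M := by
  have hatom : IsWAtom θ 𝒬 w (M⁻¹ • f) := by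
    refine ⟨hf.smul _, Or.inl ⟨Q, hQ, K, hK, ?_, ?_, ?_⟩⟩
    · exact (Function.support_const_smul_subset _ _).trans hsupp
    · filter_upwards [hbd] with x hx
      rw [Pi.smul_apply, smul_eq_mul, abs_mul, abs_of_pos (inv_pos.2 hM)]
      exact (inv_mul_le_iff₀ hM).2 hx
    · simp only [Pi.smul_apply, smul_eq_mul, mul_assoc]
      rw [integral_const_mul, h0, mul_zero]
  have := (of_isWAtom hatom).smul M
  rwa [smul_inv_smul₀ hM.ne', abs_of_pos hM, mul_one] at this

end IsAtomicSum

/-- The indicator function of `K`, normalized in `L¹(w)`. -/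
def normInd (w : Rd d → ℝ) (K : Cube d) : Rd d → ℝ :=
  K.carrier.indicator fun _ => (∫ x in K.carrier, w x)⁻¹

theorem integrable_normInd (K : Cube d) : Integrable (normInd w K) :=
  (integrable_indicator_iff K.measurableSet_carrier).2
    (integrableOn_const K.volume_carrier_ne_top)

theorem support_normInd_subset (K : Cube d) : Function.support (normInd w K) ⊆ K.carrier :=
  Set.support_indicator_subset

theorem integrableOn_mul_weight (hw : Measurable w) (hδ : 0 < δ) (hwδ : ∀ x, δ ≤ w x ∧ w x ≤ 1)
    {f : Rd d → ℝ} {s : Set (Rd d)} (hf : IntegrableOn f s) :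
    IntegrableOn (fun x => f x * w x) s := by
  refine Integrable.mul_bdd (c := 1) hf hw.aestronglyMeasurable (Eventually.of_forall fun x => ?_)
  rw [Real.norm_eq_abs, abs_of_pos (hδ.trans_le (hwδ x).1)]
  exact (hwδ x).2

theorem integral_weight_bounds (hw : Measurable w) (hδ : 0 < δ) (hwδ : ∀ x, δ ≤ w x ∧ w x ≤ 1)
    (K : Cube d) : δ * (volume K.carrier).toReal ≤ ∫ x in K.carrier, w x ∧
      ∫ x in K.carrier, w x ≤ (volume K.carrier).toReal := by
  have h1 : ∀ c : ℝ, IntegrableOn (fun _ => c) K.carrier volume := fun c =>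
    integrableOn_const K.volume_carrier_ne_top
  have hint : IntegrableOn w K.carrier := by
    simpa using integrableOn_mul_weight hw hδ hwδ (h1 1)
  constructor
  · have := setIntegral_mono (h1 δ) hint fun x => (hwδ x).1
    simpa [measureReal_def, mul_comm] using this
  · have := setIntegral_mono hint (h1 1) fun x => (hwδ x).2
    simpa [measureReal_def, mul_comm] using this

theorem abs_normInd_le (hw : Measurable w) (hδ : 0 < δ) (hwδ : ∀ x, δ ≤ w x ∧ w x ≤ 1)
    (K : Cube d) (x : Rd d) : |normInd w K x| ≤ δ⁻¹ * ((volume K.carrier).toReal)⁻¹ := by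
  have hv := K.toReal_volume_carrier_pos
  have hb := (integral_weight_bounds hw hδ hwδ K).1
  unfold normInd
  by_cases hx : x ∈ K.carrier
  · rw [Set.indicator_of_mem hx, ← mul_inv, abs_inv,
      abs_of_pos ((by positivity : 0 < δ * _).trans_le hb)]
    exact inv_anti₀ (by positivity) hb
  · rw [Set.indicator_of_notMem hx, abs_zero]
    positivity

theorem setIntegral_normInd_mul (hw : Measurable w) (hδ : 0 < δ)
    (hwδ : ∀ x, δ ≤ w x ∧ w x ≤ 1) {K B : Cube d} (h : K.carrier ⊆ B.carrier) :
    ∫ x in B.carrier, normInd w K x * w x = 1 := by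
  have hv := K.toReal_volume_carrier_pos
  have hb := (integral_weight_bounds hw hδ hwδ K).1
  have h1 : ∀ x, normInd w K x * w x =
      K.carrier.indicator (fun x => (∫ x in K.carrier, w x)⁻¹ * w x) x := by
    intro x
    unfold normInd
    by_cases hx : x ∈ K.carrier <;> simp [hx]
  simp_rw [h1]
  rw [setIntegral_indicator K.measurableSet_carrier, Set.inter_eq_right.2 h, integral_const_mul,
    inv_mul_cancel₀ ((by positivity : 0 < δ * _).trans_le hb).ne']

/-- Comparison of the normalized indicators of nested cubes of comparable size. -/
theorem isAtomicSum_normInd_sub (hw : Measurable w) (hδ : 0 < δ)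
    (hwδ : ∀ x, δ ≤ w x ∧ w x ≤ 1) {Q : Cube d} (hQ : Q ∈ 𝒬) {K B : Cube d}
    (hB : B.carrier ⊆ Q.starSet θ 2) (hKB : K.carrier ⊆ B.carrier) {ρ : ℝ} (hρ : 1 ≤ ρ)
    (hr : B.radius ≤ ρ * K.radius) :
    IsAtomicSum θ 𝒬 w (normInd w K - normInd w B) (2 * ρ ^ d * δ⁻¹) := by
  have hK := K.radius_pos
  have hBr := B.radius_pos
  refine .of_integral_eq_zero hQ hB ((integrable_normInd K).sub (integrable_normInd B)) ?_
    (by positivity) (Eventually.of_forall fun x => ?_) ?_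
  · exact (Function.support_sub _ _).trans (Set.union_subset
      ((support_normInd_subset K).trans hKB) (support_normInd_subset B))
  · have h1 := abs_normInd_le hw hδ hwδ K x
    have h2 := abs_normInd_le hw hδ hwδ B x
    have hvK := K.toReal_volume_carrier_pos
    have hvB := B.toReal_volume_carrier_pos
    have hρd : 1 ≤ ρ ^ d := one_le_pow₀ hρ
    have h3 : ((volume K.carrier).toReal)⁻¹ ≤ ρ ^ d * ((volume B.carrier).toReal)⁻¹ := by
      rw [← div_eq_mul_inv, le_div_iff₀ hvB, inv_mul_le_iff₀ hvK, K.toReal_volume_carrier,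
        B.toReal_volume_carrier, ← mul_pow]
      exact pow_le_pow_left₀ (by positivity) (by linarith) d
    have h4 : ((volume B.carrier).toReal)⁻¹ ≤ ρ ^ d * ((volume B.carrier).toReal)⁻¹ :=
      le_mul_of_one_le_left (by positivity) hρd
    calc |normInd w K x - normInd w B x| ≤ |normInd w K x| + |normInd w B x| := abs_sub _ _
      _ ≤ δ⁻¹ * (ρ ^ d * ((volume B.carrier).toReal)⁻¹) +
          δ⁻¹ * (ρ ^ d * ((volume B.carrier).toReal)⁻¹) := by
        gcongr
        · exact h1.trans (by gcongr)
        · exact h2.trans (by gcongr)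
      _ = _ := by ring
  · simp only [Pi.sub_apply, sub_mul]
    rw [integral_sub
      (integrableOn_mul_weight hw hδ hwδ (integrable_normInd K).integrableOn)
      (integrableOn_mul_weight hw hδ hwδ (integrable_normInd B).integrableOn),
      setIntegral_normInd_mul hw hδ hwδ hKB, setIntegral_normInd_mul hw hδ hwδ subset_rfl, sub_self]

/-- Comparison of the normalized indicators of nested cubes, with a constant which is logarithmic
in the ratio of their sizes. -/
theorem isAtomicSum_normInd_sub_of_le_two_pow (hw : Measurable w) (hδ : 0 < δ)
    (hwδ : ∀ x, δ ≤ w x ∧ w x ≤ 1) {Q : Cube d} (hQ : Q ∈ 𝒬) {B : Cube d}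
    (hB : B.carrier ⊆ Q.starSet θ 2) (n : ℕ) {K : Cube d} (hKB : K.carrier ⊆ B.carrier)
    (hr : B.radius ≤ 2 ^ (n + 1) * K.radius) :
    IsAtomicSum θ 𝒬 w (normInd w K - normInd w B) ((n + 1) * (2 * 2 ^ d * δ⁻¹)) := by
  induction n generalizing K with
  | zero =>
    simpa using isAtomicSum_normInd_sub hw hδ hwδ hQ hB hKB one_le_two (by simpa using hr)
  | succ n ih =>
    have hK := K.radius_pos
    by_cases h2 : B.radius ≤ 2 * K.radius
    · refine (isAtomicSum_normInd_sub hw hδ hwδ hQ hB hKB one_le_two h2).mono ?_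
      push_cast
      exact le_mul_of_one_le_left (by positivity) (by linarith [(n.cast_nonneg : (0 : ℝ) ≤ n)])
    · obtain ⟨K', hr', hKK', hK'B⟩ := Cube.exists_between (r := 2 * K.radius) hKB (by linarith)
        (not_le.1 h2).le
      have h1 := isAtomicSum_normInd_sub hw hδ hwδ hQ (hK'B.trans hB) hKK' one_le_two hr'.le
      have h3 := ih hK'B (hr.trans_eq (by rw [hr']; ring))
      have h4 := h1.add h3
      rw [sub_add_sub_cancel] at h4
      refine h4.mono (le_of_eq ?_)
      push_cast
      ring

theorem isAtomicSum_normInd_of_mem (hw : Measurable w) (hδ : 0 < δ)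
    (hwδ : ∀ x, δ ≤ w x ∧ w x ≤ 1) {Q : Cube d} (hQ : Q ∈ 𝒬) :
    IsAtomicSum θ 𝒬 w (normInd w Q) δ⁻¹ := by
  have hv := Q.toReal_volume_carrier_pos
  have hb := (integral_weight_bounds hw hδ hwδ Q).1
  have hb0 : 0 < ∫ x in Q.carrier, w x := (by positivity : 0 < δ * _).trans_le hb
  have hatom : IsWAtom θ 𝒬 w (Q.carrier.indicator fun _ => ((volume Q.carrier).toReal)⁻¹) :=
    ⟨(integrable_indicator_iff Q.measurableSet_carrier).2
      (integrableOn_const Q.volume_carrier_ne_top), Or.inr ⟨Q, hQ, rfl⟩⟩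
  have h := (IsAtomicSum.of_isWAtom hatom).smul
    ((volume Q.carrier).toReal / ∫ x in Q.carrier, w x)
  have heq : ((volume Q.carrier).toReal / ∫ x in Q.carrier, w x) •
      (Q.carrier.indicator fun _ => ((volume Q.carrier).toReal)⁻¹) = normInd w Q := by
    ext x
    unfold normInd
    by_cases hx : x ∈ Q.carrier
    · simp only [Pi.smul_apply, Set.indicator_of_mem hx, smul_eq_mul]
      field_simp
    · simp [hx]
  rw [heq] at h
  refine h.mono ?_
  rw [mul_one, abs_of_pos (by positivity), div_le_iff₀ hb0, ← div_eq_inv_mul, le_div_iff₀ hδ]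
  linarith

theorem isAtomicSum_normInd_star (hθ : 0 < θ) (hw : Measurable w) (hδ : 0 < δ)
    (hwδ : ∀ x, δ ≤ w x ∧ w x ≤ 1) {Q : Cube d} (hQ : Q ∈ 𝒬) :
    IsAtomicSum θ 𝒬 w (normInd w (Q.star hθ 2)) (δ⁻¹ + 2 * ((1 + θ) ^ 2) ^ d * δ⁻¹) := by
  have h := isAtomicSum_normInd_sub hw hδ hwδ hQ (Q.carrier_star hθ 2).subset
    (Q.carrier_subset_star hθ 2) (one_le_pow₀ (by linarith)) (le_refl ((1 + θ) ^ 2 * Q.radius))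
  have := (isAtomicSum_normInd_of_mem hw hδ hwδ hQ).sub h
  rwa [sub_sub_cancel] at this

end Atoms

theorem exists_forall_succ_mul_pow_le {r : ℝ} (hr0 : 0 ≤ r) (hr1 : r < 1) :
    ∃ M > (0 : ℝ), ∀ n : ℕ, ((n : ℝ) + 1) * r ^ n ≤ M := by
  obtain ⟨M, hM⟩ := (tendsto_self_mul_const_pow_of_lt_one hr0 hr1).bddAbove_range
  have hM' : ∀ n : ℕ, (n : ℝ) * r ^ n ≤ M := fun n => hM ⟨n, rfl⟩
  have hM0 : 0 ≤ M := by simpa using hM' 0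
  refine ⟨M + 1, by linarith, fun n => ?_⟩
  linarith [hM' n, pow_le_one₀ (n := n) hr0 hr1.le]

section Exchange

variable {d : ℕ} {θ : ℝ} {𝒬 : Set (Cube d)} {w w' : Rd d → ℝ} {δ C₀ l : ℝ}

/-- The `w'`-mean of a function with vanishing `w`-mean on a small cube is small. -/
theorem abs_setIntegral_mul_le (hd : 0 < d) (hw : Measurable w) (hw' : Measurable w') (hδ : 0 < δ)
    (hwδ : ∀ x, δ ≤ w x ∧ w x ≤ 1) (hwδ' : ∀ x, δ ≤ w' x ∧ w' x ≤ 1) (hC₀ : 0 ≤ C₀) (hl : 0 ≤ l)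
    {Q K : Cube d} (hK : K.carrier ⊆ Q.starSet θ 2)
    (hH : ∀ x ∈ Q.starSet θ 2, ∀ y ∈ Q.starSet θ 2, |w x - w y| ≤ C₀ * (‖x - y‖ / Q.diam) ^ l)
    (hH' : ∀ x ∈ Q.starSet θ 2, ∀ y ∈ Q.starSet θ 2, |w' x - w' y| ≤ C₀ * (‖x - y‖ / Q.diam) ^ l)
    {a : Rd d → ℝ} (ha : Integrable a)
    (hbd : ∀ᵐ x ∂volume, |a x| ≤ ((volume K.carrier).toReal)⁻¹)
    (h0 : ∫ x in K.carrier, a x * w x = 0) :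
    |∫ x in K.carrier, a x * w' x| ≤ (1 + δ⁻¹) * (C₀ * (K.radius / Q.radius) ^ l) := by
  have hKr := K.radius_pos
  have hQr := Q.radius_pos
  have hv := K.toReal_volume_carrier_pos
  have hdiam : K.diam / Q.diam = K.radius / Q.radius := by
    have : 0 < Real.sqrt d := Real.sqrt_pos.2 (by exact_mod_cast hd)
    unfold Cube.diam
    exact mul_div_mul_left _ _ (by positivity)
  set T := C₀ * (K.radius / Q.radius) ^ l with hT
  have hT0 : 0 ≤ T := by positivity
  have hpow : ∀ x ∈ K.carrier, ∀ y ∈ K.carrier, C₀ * (‖x - y‖ / Q.diam) ^ l ≤ T := by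
    intro x hx y hy
    have hQd : 0 ≤ Q.diam := by unfold Cube.diam; positivity
    rw [hT, ← hdiam]
    gcongr
    exact K.norm_sub_le_diam hx hy
  set x₀ := K.center
  have hx₀ : x₀ ∈ K.carrier := K.center_mem
  have hwx : 0 < w x₀ := hδ.trans_le (hwδ x₀).1
  have hwx' : 0 < w' x₀ := hδ.trans_le (hwδ' x₀).1
  set κ := w' x₀ / w x₀ with hκ
  have hκ0 : 0 < κ := div_pos hwx' hwx
  have hκ1 : κ ≤ δ⁻¹ := by
    rw [hκ, ← one_div]
    exact div_le_div₀ zero_le_one (hwδ' x₀).2 hδ (hwδ x₀).1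
  have hκw : κ * w x₀ = w' x₀ := div_mul_cancel₀ _ hwx.ne'
  have heq : ∫ x in K.carrier, a x * w' x = ∫ x in K.carrier, a x * (w' x - κ * w x) := by
    have h1 : ∀ x, a x * (w' x - κ * w x) = a x * w' x - κ * (a x * w x) := fun x => by ring
    simp_rw [h1]
    rw [integral_sub (integrableOn_mul_weight hw' hδ hwδ' ha.integrableOn)
      ((integrableOn_mul_weight hw hδ hwδ ha.integrableOn).const_mul κ), integral_const_mul, h0,
      mul_zero, sub_zero]
  have hdiff : ∀ y ∈ K.carrier, |w' y - κ * w y| ≤ (1 + δ⁻¹) * T := by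
    intro y hy
    have e : w' y - κ * w y = (w' y - w' x₀) + κ * (w x₀ - w y) := by rw [← hκw]; ring
    calc |w' y - κ * w y| ≤ |w' y - w' x₀| + |κ * (w x₀ - w y)| := by rw [e]; exact abs_add_le _ _
      _ = |w' y - w' x₀| + κ * |w x₀ - w y| := by rw [abs_mul, abs_of_pos hκ0]
      _ ≤ T + δ⁻¹ * T := by
        gcongr
        · exact (hH' y (hK hy) x₀ (hK hx₀)).trans (hpow y hy x₀ hx₀)
        · exact (hH x₀ (hK hx₀) y (hK hy)).trans (hpow x₀ hx₀ y hy)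
      _ = _ := by ring
  have hfin := norm_setIntegral_le_of_norm_le_const_ae'
    (f := fun x => a x * (w' x - κ * w x))
    (C := ((volume K.carrier).toReal)⁻¹ * ((1 + δ⁻¹) * T)) K.volume_carrier_ne_top.lt_top
    (by
      filter_upwards [hbd] with x hx hxK
      rw [norm_mul]
      exact mul_le_mul hx (hdiff x hxK) (norm_nonneg _) (by positivity))
  rw [heq]
  refine hfin.trans_eq ?_
  rw [measureReal_def]
  field_simp

/-- Atoms for the weight `w` are uniformly bounded in the atomic space for the weight `w'`. -/
theorem exists_forall_isAtomicSum (hd : 0 < d) (hθ : 0 < θ) (hw : Measurable w)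
    (hw' : Measurable w') (hδ : 0 < δ) (hwδ : ∀ x, δ ≤ w x ∧ w x ≤ 1)
    (hwδ' : ∀ x, δ ≤ w' x ∧ w' x ≤ 1) (hC₀ : 0 ≤ C₀) (hl : 0 < l)
    (hH : ∀ Q ∈ 𝒬, ∀ x ∈ Q.starSet θ 2, ∀ y ∈ Q.starSet θ 2,
      |w x - w y| ≤ C₀ * (‖x - y‖ / Q.diam) ^ l)
    (hH' : ∀ Q ∈ 𝒬, ∀ x ∈ Q.starSet θ 2, ∀ y ∈ Q.starSet θ 2,
      |w' x - w' y| ≤ C₀ * (‖x - y‖ / Q.diam) ^ l) :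
    ∃ M > (0 : ℝ), ∀ a, IsWAtom θ 𝒬 w a → IsAtomicSum θ 𝒬 w' a M := by
  have hr1 : (2 : ℝ) ^ (-l) < 1 := Real.rpow_lt_one_of_one_lt_of_neg one_lt_two (by linarith)
  obtain ⟨N, hN0, hN⟩ := exists_forall_succ_mul_pow_le (by positivity) hr1
  set A := (1 + δ⁻¹) * (C₀ * ((1 + θ) ^ 2) ^ l) with hA
  set P := 2 * 2 ^ d * δ⁻¹
  set R := δ⁻¹ + 2 * ((1 + θ) ^ 2) ^ d * δ⁻¹
  have hA0 : 0 ≤ A := by positivity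
  have hP0 : 0 ≤ P := by positivity
  have hR0 : 0 ≤ R := by positivity
  refine ⟨(1 + A * δ⁻¹) + A * N * (P + R) + 1, by positivity, ?_⟩
  rintro a ⟨ha, ⟨Q, hQ, K, hK, hsupp, hbd, h0⟩ | hQ⟩
  swap
  · exact (IsAtomicSum.of_isWAtom ⟨ha, Or.inr hQ⟩).mono
      (le_add_of_nonneg_left (by positivity))
  have hKr := K.radius_pos
  have hQr := Q.radius_pos
  set B := Q.star hθ 2
  have hBr : B.radius = (1 + θ) ^ 2 * Q.radius := rfl
  have hKB : K.carrier ⊆ B.carrier := hK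
  obtain ⟨n, hn1, hn2⟩ := exists_nat_pow_near
    ((one_le_div hKr).2 (Cube.radius_le_of_subset hd hKB)) one_lt_two
  rw [le_div_iff₀ hKr] at hn1
  rw [div_lt_iff₀ hKr] at hn2
  set c := ∫ x in K.carrier, a x * w' x
  have hcbd : |c| ≤ A * ((2 : ℝ) ^ (-l)) ^ n := by
    refine (abs_setIntegral_mul_le hd hw hw' hδ hwδ hwδ' hC₀ hl.le hK (hH Q hQ) (hH' Q hQ) ha hbd
      h0).trans ?_
    have h1 : K.radius / Q.radius ≤ (1 + θ) ^ 2 * ((2 : ℝ) ^ n)⁻¹ := by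
      rw [← div_eq_mul_inv, div_le_div_iff₀ hQr (by positivity)]
      linarith
    have h2 : ((1 + θ) ^ 2 * ((2 : ℝ) ^ n)⁻¹) ^ l = ((1 + θ) ^ 2) ^ l * ((2 : ℝ) ^ (-l)) ^ n := by
      rw [Real.mul_rpow (by positivity) (by positivity), Real.inv_rpow (by positivity),
        Real.rpow_neg (by positivity), inv_pow, Real.rpow_pow_comm (by positivity)]
    calc _ ≤ (1 + δ⁻¹) * (C₀ * ((1 + θ) ^ 2 * ((2 : ℝ) ^ n)⁻¹) ^ l) := by gcongr
      _ = _ := by rw [h2, hA]; ring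
  have hrn0 : 0 ≤ ((2 : ℝ) ^ (-l)) ^ n := by positivity
  have hrn1 : ((2 : ℝ) ^ (-l)) ^ n ≤ 1 := pow_le_one₀ (by positivity) hr1.le
  have hcA : |c| ≤ A := hcbd.trans (mul_le_of_le_one_right hA0 hrn1)
  have hn0 : (0 : ℝ) ≤ n := n.cast_nonneg
  have hcN : |c| * (n + 1) ≤ A * N := by
    calc |c| * (n + 1) ≤ A * ((2 : ℝ) ^ (-l)) ^ n * (n + 1) := by gcongr
      _ = A * ((n + 1) * ((2 : ℝ) ^ (-l)) ^ n) := by ring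
      _ ≤ A * N := by gcongr; exact hN n
  have hcN' : |c| ≤ A * N :=
    (le_mul_of_one_le_right (abs_nonneg c) (by linarith)).trans hcN
  have hv := K.toReal_volume_carrier_pos
  have h1 : IsAtomicSum θ 𝒬 w' (a - c • normInd w' K) (1 + A * δ⁻¹) := by
    refine .of_integral_eq_zero hQ hK (ha.sub ((integrable_normInd K).smul c)) ?_ (by positivity)
      ?_ ?_
    · exact (Function.support_sub _ _).trans (Set.union_subset hsupp
        ((Function.support_const_smul_subset _ _).trans (support_normInd_subset K)))
    · filter_upwards [hbd] with x hx
      calc |a x - c * normInd w' K x| ≤ |a x| + |c * normInd w' K x| := abs_sub _ _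
        _ ≤ ((volume K.carrier).toReal)⁻¹ + A * (δ⁻¹ * ((volume K.carrier).toReal)⁻¹) := by
          rw [abs_mul]
          gcongr
          exact abs_normInd_le hw' hδ hwδ' K x
        _ = _ := by ring
    · simp only [Pi.sub_apply, Pi.smul_apply, smul_eq_mul, sub_mul, mul_assoc]
      rw [integral_sub (integrableOn_mul_weight hw' hδ hwδ' ha.integrableOn)
        ((integrableOn_mul_weight hw' hδ hwδ' (integrable_normInd K).integrableOn).const_mul c),
        integral_const_mul, setIntegral_normInd_mul hw' hδ hwδ' subset_rfl, mul_one, sub_self]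
  have h2 := (isAtomicSum_normInd_sub_of_le_two_pow hw' hδ hwδ' hQ (Q.carrier_star hθ 2).subset n
    hKB hn2.le).smul c
  have h3 := (isAtomicSum_normInd_star hθ hw' hδ hwδ' hQ).smul c
  have h4 := (h1.add h2).add h3
  have e : a - c • normInd w' K + c • (normInd w' K - normInd w' (Q.star hθ 2)) +
      c • normInd w' (Q.star hθ 2) = a := by
    rw [smul_sub]; abel
  rw [e] at h4
  refine h4.mono ?_
  have h5 : |c| * ((n + 1) * P) ≤ A * N * P := by
    rw [← mul_assoc]
    gcongr
  have h6 : |c| * R ≤ A * N * R := by gcongr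
  linarith

/-- Continuous embedding between the atomic spaces for two weights. -/
theorem exists_H1atNorm_le (hd : 0 < d) (hθ : 0 < θ) (hw : Measurable w)
    (hw' : Measurable w') (hδ : 0 < δ) (hwδ : ∀ x, δ ≤ w x ∧ w x ≤ 1)
    (hwδ' : ∀ x, δ ≤ w' x ∧ w' x ≤ 1) (hC₀ : 0 ≤ C₀) (hl : 0 < l)
    (hH : ∀ Q ∈ 𝒬, ∀ x ∈ Q.starSet θ 2, ∀ y ∈ Q.starSet θ 2,
      |w x - w y| ≤ C₀ * (‖x - y‖ / Q.diam) ^ l)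
    (hH' : ∀ Q ∈ 𝒬, ∀ x ∈ Q.starSet θ 2, ∀ y ∈ Q.starSet θ 2,
      |w' x - w' y| ≤ C₀ * (‖x - y‖ / Q.diam) ^ l) :
    ∃ M > (0 : ℝ), ∀ f : Rd d → ℝ, Integrable f → MemH1at (IsWAtom θ 𝒬 w) f →
      MemH1at (IsWAtom θ 𝒬 w') f ∧
        H1atNorm (IsWAtom θ 𝒬 w') f ≤ M * H1atNorm (IsWAtom θ 𝒬 w) f := by
  obtain ⟨M, hM, h⟩ := exists_forall_isAtomicSum hd hθ hw hw' hδ hwδ hwδ' hC₀ hl hH hH'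
  refine ⟨M, hM, fun f hf hmem => H1atNorm_le_of_atomicSum (fun a ha => ha.1)
    norm_le_one_of_mem_atomClasses (fun a ha => ha.1) norm_le_one_of_mem_atomClasses hM ?_ hf hmem⟩
  rintro _ ⟨a, ha, hatom, rfl⟩
  obtain ⟨_, h'⟩ := h a hatom
  exact h'

end Exchange

theorem H1atNorm_nonneg {d : ℕ} (𝒜 : (Rd d → ℝ) → Prop) (f : Rd d → ℝ) : 0 ≤ H1atNorm 𝒜 f := by
  refine Real.sInf_nonneg ?_
  rintro _ ⟨_, _, _, rfl⟩
  exact tsum_nonneg fun _ => abs_nonneg _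

/-- if `𝒬` satisfies (G), `0 < δ ≤ ω ≤ 1`, and `ω` satisfies the Lipschitz-type
condition `|ω(x) - ω(y)| ≤ C₀ (|x-y|/d_Q)^λ` on `Q^{**}` for each `Q ∈ 𝒬`, then the atomic
Hardy spaces for `𝒬`-atoms and `(ω,𝒬)`-atoms coincide with comparable norms. -/
theorem statement3 (d : ℕ) (hd : 3 ≤ d) (θ : ℝ) (hθ : 0 < θ) (CG : ℝ) (hCG : 1 ≤ CG)
    (𝒬 : Set (Cube d)) (hG : SatG θ CG 𝒬)
    (ω : Rd d → ℝ) (hωmeas : Measurable ω)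
    (δ : ℝ) (hδ : 0 < δ) (hω : ∀ x, δ ≤ ω x ∧ ω x ≤ 1)
    (C₀ l : ℝ) (hC₀ : 0 < C₀) (hl : 0 < l)
    (hHolder : ∀ Q ∈ 𝒬, ∀ x ∈ Q.starSet θ 2, ∀ y ∈ Q.starSet θ 2,
      |ω x - ω y| ≤ C₀ * (‖x - y‖ / Q.diam) ^ l) :
    ∃ C > (0 : ℝ), ∀ f : Rd d → ℝ, Integrable f →
      (MemH1at (IsWAtom θ 𝒬 (fun _ => 1)) f ↔ MemH1at (IsWAtom θ 𝒬 ω) f) ∧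
      (MemH1at (IsWAtom θ 𝒬 (fun _ => 1)) f →
        C⁻¹ * H1atNorm (IsWAtom θ 𝒬 (fun _ => 1)) f ≤ H1atNorm (IsWAtom θ 𝒬 ω) f ∧
        H1atNorm (IsWAtom θ 𝒬 ω) f ≤ C * H1atNorm (IsWAtom θ 𝒬 (fun _ => 1)) f) := by
  have hd0 : 0 < d := by omega
  have hδ1 : δ ≤ 1 := (hω 0).1.trans (hω 0).2
  have h1 : ∀ Q ∈ 𝒬, ∀ x ∈ Q.starSet θ 2, ∀ y ∈ Q.starSet θ 2,
      |(fun _ : Rd d => (1 : ℝ)) x - (fun _ : Rd d => (1 : ℝ)) y| ≤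
        C₀ * (‖x - y‖ / Q.diam) ^ l := by
    intro Q _ x _ y _
    have hQr := Q.radius_pos
    have hQd : 0 ≤ Q.diam := by unfold Cube.diam; positivity
    rw [sub_self, abs_zero]
    positivity
  have h1δ : ∀ _x : Rd d, δ ≤ 1 ∧ (1 : ℝ) ≤ 1 := fun _ => ⟨hδ1, le_rfl⟩
  obtain ⟨M, hM, hMf⟩ := exists_H1atNorm_le hd0 hθ measurable_const hωmeas hδ h1δ hω hC₀.le hl
    h1 hHolder
  obtain ⟨M', hM', hMf'⟩ := exists_H1atNorm_le hd0 hθ hωmeas measurable_const hδ hω h1δ hC₀.le hl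
    hHolder h1
  refine ⟨max M M', lt_max_of_lt_left hM, fun f hf =>
    ⟨⟨fun h => (hMf f hf h).1, fun h => (hMf' f hf h).1⟩, fun h => ⟨?_, ?_⟩⟩⟩
  · rw [inv_mul_le_iff₀ (lt_max_of_lt_left hM)]
    exact (hMf' f hf (hMf f hf h).1).2.trans
      (mul_le_mul_of_nonneg_right (le_max_right _ _) (H1atNorm_nonneg _ _))
  · exact (hMf f hf h).2.trans
      (mul_le_mul_of_nonneg_right (le_max_left _ _) (H1atNorm_nonneg _ _))
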